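/- For all real numbers β and γ there exist real numbers θ and φ such that Rx(β) · Ry(γ) · Rx(β) = R(θ, φ); equivalently, R(θ, φ) · Rx(-β) · Ry(-γ) · Rx(-β) equals the 2×2 identity matrix. -/

import Mathlib

open Matrix

/-- The single-qubit rotation gate `Rx(θ)`. -/
noncomputable def Rx (θ : ℝ) : Matrix (Fin 2) (Fin 2) ℂ :=
  !![Real.cos (θ / 2), Complex.I * Real.sin (θ / 2);
     Complex.I * Real.sin (θ / 2), Real.cos (θ / 2)]

/-- The single-qubit rotation gate `Ry(θ)`. -/
noncomputable def Ry (θ : ℝ) : Matrix (Fin 2) (Fin 2) ℂ :=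
  !![Real.cos (θ / 2), Real.sin (θ / 2);
     -Real.sin (θ / 2), Real.cos (θ / 2)]

/-- The trapped-ion single-qubit gate `R(θ, φ)`. -/
noncomputable def Rgate (θ φ : ℝ) : Matrix (Fin 2) (Fin 2) ℂ :=
  !![Real.cos (θ / 2), -Complex.I * Complex.exp (-(Complex.I * φ)) * Real.sin (θ / 2);
     -Complex.I * Complex.exp (Complex.I * φ) * Real.sin (θ / 2), Real.cos (θ / 2)]

theorem Rx_mul_Rx_neg (θ : ℝ) : Rx θ * Rx (-θ) = 1 := by
  have h : (Real.cos (θ / 2) : ℂ) ^ 2 + (Real.sin (θ / 2) : ℂ) ^ 2 = 1 := by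
    exact_mod_cast Real.cos_sq_add_sin_sq (θ / 2)
  simp only [Rx, neg_div, Real.cos_neg, Real.sin_neg, Complex.ofReal_neg]
  ext i j
  fin_cases i <;> fin_cases j <;> simp only [Matrix.mul_apply, Fin.sum_univ_two] <;>
    simp [-Complex.ofReal_cos, -Complex.ofReal_sin] <;>
    grind [Complex.I_sq]

theorem Ry_mul_Ry_neg (θ : ℝ) : Ry θ * Ry (-θ) = 1 := by
  have h : (Real.cos (θ / 2) : ℂ) ^ 2 + (Real.sin (θ / 2) : ℂ) ^ 2 = 1 := by
    exact_mod_cast Real.cos_sq_add_sin_sq (θ / 2)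
  simp only [Ry, neg_div, Real.cos_neg, Real.sin_neg, Complex.ofReal_neg]
  ext i j
  fin_cases i <;> fin_cases j <;> simp only [Matrix.mul_apply, Fin.sum_univ_two] <;>
    simp [-Complex.ofReal_cos, -Complex.ofReal_sin] <;>
    grind

/-- Spherical coordinates on the unit sphere of `ℝ³`, with a halved polar angle. -/
theorem exists_spherical_angles {a b d : ℝ} (h : a ^ 2 + b ^ 2 + d ^ 2 = 1) :
    ∃ θ φ : ℝ, Real.cos (θ / 2) = a ∧ Real.cos φ * Real.sin (θ / 2) = b ∧
      Real.sin φ * Real.sin (θ / 2) = d := by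
  have hs : √(1 - a ^ 2) = ‖(⟨b, d⟩ : ℂ)‖ := by
    rw [Complex.norm_def, Complex.normSq_mk]
    congr 1
    linarith
  refine ⟨2 * Real.arccos a, Complex.arg ⟨b, d⟩, ?_, ?_, ?_⟩
  · rw [mul_div_cancel_left₀ _ two_ne_zero, Real.cos_arccos] <;> nlinarith
  · rw [mul_div_cancel_left₀ _ two_ne_zero, Real.sin_arccos, hs, mul_comm,
      Complex.norm_mul_cos_arg]
  · rw [mul_div_cancel_left₀ _ two_ne_zero, Real.sin_arccos, hs, mul_comm,
      Complex.norm_mul_sin_arg]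

theorem Rgate_eq (θ φ : ℝ) :
    Rgate θ φ =
      !![(Real.cos (θ / 2) : ℂ), -((Real.sin φ * Real.sin (θ / 2) : ℝ) : ℂ) -
          Complex.I * (Real.cos φ * Real.sin (θ / 2) : ℝ);
        ((Real.sin φ * Real.sin (θ / 2) : ℝ) : ℂ) -
          Complex.I * (Real.cos φ * Real.sin (θ / 2) : ℝ), (Real.cos (θ / 2) : ℂ)] := by
  have hp : Complex.exp (Complex.I * φ) = Real.cos φ + Real.sin φ * Complex.I := by
    rw [mul_comm, Complex.exp_mul_I, Complex.ofReal_cos, Complex.ofReal_sin]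
  have hm : Complex.exp (-(Complex.I * φ)) = Real.cos φ - Real.sin φ * Complex.I := by
    rw [mul_comm, ← neg_mul, Complex.exp_mul_I, Complex.cos_neg, Complex.sin_neg,
      Complex.ofReal_cos, Complex.ofReal_sin]
    ring
  rw [Rgate, hp, hm]
  ext i j
  fin_cases i <;> fin_cases j <;> simp [-Complex.ofReal_cos, -Complex.ofReal_sin] <;>
    grind [Complex.I_sq]

theorem Rx_mul_Ry_mul_Rx (β γ : ℝ) :
    Rx β * Ry γ * Rx β =
      !![((Real.cos (γ / 2) * Real.cos β : ℝ) : ℂ),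
          Real.sin (γ / 2) + Complex.I * (Real.cos (γ / 2) * Real.sin β : ℝ);
        -(Real.sin (γ / 2) : ℂ) + Complex.I * (Real.cos (γ / 2) * Real.sin β : ℝ),
          ((Real.cos (γ / 2) * Real.cos β : ℝ) : ℂ)] := by
  have h : (Real.cos (β / 2) : ℂ) ^ 2 + (Real.sin (β / 2) : ℂ) ^ 2 = 1 := by
    exact_mod_cast Real.cos_sq_add_sin_sq (β / 2)
  have hc : Real.cos β = 2 * Real.cos (β / 2) ^ 2 - 1 := by
    rw [← Real.cos_two_mul, mul_div_cancel₀ _ two_ne_zero]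
  have hs : Real.sin β = 2 * Real.sin (β / 2) * Real.cos (β / 2) := by
    rw [← Real.sin_two_mul, mul_div_cancel₀ _ two_ne_zero]
  rw [hc, hs, Rx, Ry]
  ext i j
  fin_cases i <;> fin_cases j <;> simp only [Matrix.mul_apply, Fin.sum_univ_two] <;>
    simp [-Complex.ofReal_cos, -Complex.ofReal_sin] <;>
    grind [Complex.I_sq]

/-- For all reals `β` and `γ` there exist `θ` and `φ` such that
`Rx(β) · Ry(γ) · Rx(β) = R(θ, φ)`; equivalently,
`R(θ, φ) · Rx(-β) · Ry(-γ) · Rx(-β) = 1`. -/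
theorem rx_ry_rx_eq_Rgate (β γ : ℝ) :
    ∃ θ φ : ℝ, Rx β * Ry γ * Rx β = Rgate θ φ ∧
      Rgate θ φ * Rx (-β) * Ry (-γ) * Rx (-β) = 1 := by
  obtain ⟨θ, φ, ha, hb, hd⟩ := exists_spherical_angles (a := Real.cos (γ / 2) * Real.cos β)
    (b := -(Real.cos (γ / 2) * Real.sin β)) (d := -Real.sin (γ / 2)) (by
      linear_combination Real.cos (γ / 2) ^ 2 * Real.cos_sq_add_sin_sq β +
        Real.cos_sq_add_sin_sq (γ / 2))
  have h : Rx β * Ry γ * Rx β = Rgate θ φ := by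
    rw [Rx_mul_Ry_mul_Rx, Rgate_eq, ha, hb, hd]
    simp only [Complex.ofReal_neg, neg_neg, mul_neg, sub_neg_eq_add]
  refine ⟨θ, φ, h, ?_⟩
  rw [← h, mul_assoc _ (Rx β), Rx_mul_Rx_neg, mul_one, mul_assoc (Rx β), Ry_mul_Ry_neg,
    mul_one, Rx_mul_Rx_neg]
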